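/- Throw N balls independently into M bins, where each ball lands in bin i with probability p_i ≥ 0 and Σ_{i=0}^{M−1} p_i = 1; formally, take the product of N copies of the probability mass function p on Fin M, defined on functions f : Fin N → Fin M, and let count_i(f) be the number of balls in bin i. Let u be a natural number and let S ⊆ Fin M be a subset with |S| = J and u · J ≤ N. Then the probability of the event { f | count_i(f) = u for every i ∈ S } equals ( ∏_{y=0}^{J−1} C( N − u·y , u ) ) · ( ∏_{i∈S} p_i )^u · ( 1 − Σ_{i∈S} p_i )^{N − u·J}. -/

import Mathlib

open MeasureTheory

/-- The total weight of the functions `f : ι → κ` that take every value in `S` exactly `u` times,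
where the points of `A` carry the weights `p` and the other points give no weight to `S`. -/
theorem sum_prod_weight_filter_card_fiber_eq {ι κ R : Type*} [Fintype ι] [DecidableEq ι]
    [Fintype κ] [DecidableEq κ] [CommSemiring R] (u : ℕ) (S : Finset κ) (A : Finset ι)
    (p : κ → R) (w : ι → κ → R) (hA : ∀ n ∈ A, w n = p)
    (hS : ∀ n ∉ A, ∀ k ∈ S, w n k = 0) :
    ∑ f : ι → κ with ∀ i ∈ S, (Finset.univ.filter fun n => f n = i).card = u, ∏ n, w n (f n) =
      (∏ y ∈ Finset.range S.card, ((A.card - u * y).choose u : R)) * (∏ i ∈ S, p i) ^ u *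
        (∑ k ∈ Sᶜ, p k) ^ (A.card - u * S.card) * ∏ n ∈ Aᶜ, ∑ k, w n k := by
  induction S using Finset.induction_on generalizing A p w with
  | empty =>
    have h : ∏ n ∈ A, ∑ k, w n k = (∑ k, p k) ^ A.card := by
      rw [← Finset.prod_const]
      exact Finset.prod_congr rfl fun n hn => by rw [hA n hn]
    simp [← h, Finset.prod_mul_prod_compl, Fintype.prod_sum]
  | insert a S ha ih =>
    let v (T : Finset ι) (n : ι) (k : κ) : R := if n ∈ T ↔ k = a then w n k else 0
    have hv (T : Finset ι) (f : ι → κ) : ∏ n, v T n (f n) =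
        if (Finset.univ.filter fun n => f n = a) = T then ∏ n, w n (f n) else 0 := by
      split_ifs with h
      · subst h
        simp [v]
      · obtain ⟨n, hn⟩ : ∃ n, ¬ (n ∈ T ↔ f n = a) := by
          by_contra! h'
          exact h (by ext n; simp [h'])
        exact Finset.prod_eq_zero (Finset.mem_univ n) (if_neg hn)
    have hsplit : ∑ f : ι → κ with ∀ i ∈ insert a S,
          (Finset.univ.filter fun n => f n = i).card = u, ∏ n, w n (f n) =
        ∑ T ∈ Finset.univ.powersetCard u, ∑ f : ι → κ with ∀ i ∈ S,
          (Finset.univ.filter fun n => f n = i).card = u, ∏ n, v T n (f n) := by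
      rw [Finset.sum_comm]
      simp_rw [hv, Finset.sum_ite_eq, Finset.mem_powersetCard_univ]
      rw [← Finset.sum_filter, Finset.filter_filter]
      simp_rw [Finset.forall_mem_insert, and_comm]
    have hsubset : ∑ T ∈ Finset.univ.powersetCard u, ∑ f : ι → κ with ∀ i ∈ S,
          (Finset.univ.filter fun n => f n = i).card = u, ∏ n, v T n (f n) =
        ∑ T ∈ A.powersetCard u, ∑ f : ι → κ with ∀ i ∈ S,
          (Finset.univ.filter fun n => f n = i).card = u, ∏ n, v T n (f n) := by
      symm
      refine Finset.sum_subset (Finset.powersetCard_mono (Finset.subset_univ A)) ?_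
      intro T hT hTA
      rw [Finset.mem_powersetCard_univ] at hT
      obtain ⟨n, hnT, hnA⟩ : ∃ n ∈ T, n ∉ A := by
        by_contra! h
        exact hTA (Finset.mem_powersetCard.2 ⟨h, hT⟩)
      refine Finset.sum_eq_zero fun f _ => Finset.prod_eq_zero (Finset.mem_univ n) ?_
      by_cases hf : f n = a
      · simp [v, hf, hS n hnA a (Finset.mem_insert_self a S)]
      · simp [v, hf, hnT]
    have hcompl : ∑ k ∈ Sᶜ, Function.update p a 0 k = ∑ k ∈ (insert a S)ᶜ, p k := by
      rw [Finset.compl_insert, Finset.sum_update_of_mem (Finset.mem_compl.2 ha), zero_add,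
        Finset.sdiff_singleton_eq_erase]
    have hprod : ∏ i ∈ S, Function.update p a 0 i = ∏ i ∈ S, p i :=
      Finset.prod_update_of_notMem ha p 0
    have hterm (T : Finset ι) (hT : T ∈ A.powersetCard u) :
        ∑ f : ι → κ with ∀ i ∈ S,
          (Finset.univ.filter fun n => f n = i).card = u, ∏ n, v T n (f n) =
        (∏ y ∈ Finset.range S.card, ((A.card - u * (y + 1)).choose u : R)) *
          (∏ i ∈ insert a S, p i) ^ u * (∑ k ∈ (insert a S)ᶜ, p k) ^
            (A.card - u * (insert a S).card) * ∏ n ∈ Aᶜ, ∑ k, w n k := by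
      obtain ⟨hTA, hTu⟩ := Finset.mem_powersetCard.1 hT
      have hinside (n : ι) (hn : n ∈ T) : ∑ k, v T n k = p a := by
        simp [v, hn, hA n (hTA hn)]
      have houtside (n : ι) (hn : n ∈ Aᶜ) : ∑ k, v T n k = ∑ k, w n k := by
        rw [Finset.mem_compl] at hn
        refine Finset.sum_congr rfl fun k _ => ?_
        by_cases hk : k = a
        · simp [v, hk, hS n hn a (Finset.mem_insert_self a S)]
        · have hnT : n ∉ T := fun h => hn (hTA h)
          simp [v, hk, hnT]
      have hrest : ∏ n ∈ (A \ T)ᶜ, ∑ k, v T n k = p a ^ u * ∏ n ∈ Aᶜ, ∑ k, w n k := by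
        have hdisj : Disjoint T Aᶜ :=
          Finset.disjoint_left.2 fun n hn h => Finset.mem_compl.1 h (hTA hn)
        have hunion : (A \ T)ᶜ = T ∪ Aᶜ := by
          ext n
          simp only [Finset.mem_compl, Finset.mem_sdiff, Finset.mem_union]
          tauto
        rw [hunion, Finset.prod_union hdisj, Finset.prod_congr rfl hinside,
          Finset.prod_congr rfl houtside, Finset.prod_const, hTu]
      rw [ih (A \ T) (Function.update p a 0) (v T), hrest, hcompl, hprod,
        Finset.card_sdiff_of_subset hTA, hTu, Finset.prod_insert ha,
        Finset.card_insert_of_notMem ha]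
      · simp_rw [Nat.sub_sub, mul_add_one, add_comm u]
        ring
      · intro n hn
        rw [Finset.mem_sdiff] at hn
        funext k
        by_cases hk : k = a
        · simp [v, hk, hn.2]
        · simp [v, hk, hn.2, hA n hn.1]
      · intro n hn k hk
        have hka : k ≠ a := fun h => ha (h ▸ hk)
        by_cases hnT : n ∈ T
        · simp [v, hka, hnT]
        · have hnA : n ∉ A := fun h => hn (Finset.mem_sdiff.2 ⟨h, hnT⟩)
          simp [v, hS n hnA k (Finset.mem_insert_of_mem hk)]
    rw [hsplit, hsubset, Finset.sum_congr rfl hterm, Finset.sum_const,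
      Finset.card_powersetCard, nsmul_eq_mul, Finset.card_insert_of_notMem ha,
      Finset.prod_range_succ']
    simp only [mul_zero, Nat.sub_zero]
    ring

/-- Joint-occupancy building block of the paper's Theorem 1: throw `N` balls
independently into `M` bins with probabilities `p i` (`p i ≥ 0`, `Σ p i = 1`).  For a
subset `S` of the bins with `|S| = J` and `u·J ≤ N`, the probability that every bin of
`S` contains exactly `u` balls equals
`(∏_{y<J} C(N − u·y, u)) · (∏_{i∈S} p i)^u · (1 − Σ_{i∈S} p i)^{N − u·J}`. -/
theorem balls_in_bins_joint_occupancy (N M : ℕ) (p : Fin M → ℝ) (hp : ∀ i, 0 ≤ p i)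
    (hsum : ∑ i, p i = 1) (u : ℕ) (S : Finset (Fin M)) (J : ℕ) (hJ : S.card = J)
    (huJ : u * J ≤ N) :
    (Measure.pi fun _ : Fin N =>
        ((PMF.ofFintype (fun i => ENNReal.ofReal (p i))
          (by rw [← ENNReal.ofReal_sum_of_nonneg (fun i _ => hp i), hsum,
                ENNReal.ofReal_one])).toMeasure))
      {f : Fin N → Fin M | ∀ i ∈ S, (Finset.univ.filter fun n => f n = i).card = u} =
    ENNReal.ofReal
      ((∏ y ∈ Finset.range J, ((N - u * y).choose u : ℝ)) *
        (∏ i ∈ S, p i) ^ u * (1 - ∑ i ∈ S, p i) ^ (N - u * J)) := by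
  have hweight := sum_prod_weight_filter_card_fiber_eq u S (Finset.univ : Finset (Fin N)) p
    (fun _ => p) (fun _ _ => rfl) (by simp)
  have hevent : {f : Fin N → Fin M | ∀ i ∈ S, (Finset.univ.filter fun n => f n = i).card = u} =
      ↑(Finset.univ.filter fun f : Fin N → Fin M =>
        ∀ i ∈ S, (Finset.univ.filter fun n => f n = i).card = u) := by
    simp
  have hcompl : ∑ k ∈ Sᶜ, p k = 1 - ∑ i ∈ S, p i := by
    rw [← hsum, ← Finset.sum_add_sum_compl S p, add_sub_cancel_left]
  simp only [Finset.card_univ, Fintype.card_fin, Finset.compl_univ, Finset.prod_empty, mul_one,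
    hcompl, hJ] at hweight
  rw [← hweight, ENNReal.ofReal_sum_of_nonneg fun f _ => Finset.prod_nonneg fun n _ => hp (f n),
    hevent, ← sum_measure_singleton]
  refine Finset.sum_congr (by ext; simp) fun f _ => ?_
  rw [Measure.pi_singleton, ENNReal.ofReal_prod_of_nonneg fun n _ => hp (f n)]
  refine Finset.prod_congr rfl fun n _ => ?_
  rw [PMF.toMeasure_apply_singleton _ _ (measurableSet_singleton _), PMF.ofFintype_apply]
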